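/- (Strong Compact–Fredholm Alternative) Let a ∈ I₁ and let M be a nonzero left I₁-module of finite length; denote by a_M : M → M the K-linear map m ↦ a·m. Then: (a) the kernel of a_M is a finite-dimensional K-vector space if and only if the cokernel M/(a·M) is a finite-dimensional K-vector space, and both hold if and only if a ∉ F; (b) if moreover M is a simple I₁-module, then the image a·M is a finite-dimensional K-vector space if and only if a ∈ F. -/

import Mathlib

open Polynomial

noncomputable section
set_option synthInstance.maxHeartbeats 1000000
set_option maxHeartbeats 1000000
set_option linter.unusedSectionVars false

variable (K : Type*) [Field K] [CharZero K]

/-- The derivative operator `∂ = d/dx` on `K[x]`. -/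
def derOp : Module.End K (Polynomial K) := Polynomial.derivative

/-- The multiplication-by-`x` operator on `K[x]`. -/
def xOp : Module.End K (Polynomial K) := LinearMap.mulLeft K Polynomial.X

/-- The integration operator `∫`, determined by `∫ xⁿ = xⁿ⁺¹/(n+1)`. -/
def intOp : Module.End K (Polynomial K) :=
  (Polynomial.basisMonomials K).constr K fun n => ((n : K) + 1)⁻¹ • X ^ (n + 1)

/-- The algebra `I₁` of polynomial integro-differential operators: the subalgebra of
`End_K(K[x])` generated by `x`, `∂` and `∫`. -/
def I1 : Subalgebra K (Module.End K (Polynomial K)) :=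
  Algebra.adjoin K {xOp K, derOp K, intOp K}

/-- `e_{ij} := ∫^i ∂^j − ∫^{i+1} ∂^{j+1}`. -/
def eOp (i j : ℕ) : Module.End K (Polynomial K) :=
  intOp K ^ i * derOp K ^ j - intOp K ^ (i + 1) * derOp K ^ (j + 1)

/-- `F`, the `K`-linear span of the `e_{ij}`; it is the (two-sided) ideal of compact
operators of `I₁`. -/
def Fset : Submodule K (Module.End K (Polynomial K)) :=
  Submodule.span K {f | ∃ i j, f = eOp K i j}

lemma xOp_mem : xOp K ∈ I1 K := Algebra.subset_adjoin (by simp)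
lemma derOp_mem : derOp K ∈ I1 K := Algebra.subset_adjoin (by simp)
lemma intOp_mem : intOp K ∈ I1 K := Algebra.subset_adjoin (by simp)

lemma eOp_mem (i j : ℕ) : eOp K i j ∈ I1 K :=
  sub_mem (mul_mem (pow_mem (intOp_mem K) i) (pow_mem (derOp_mem K) j))
    (mul_mem (pow_mem (intOp_mem K) (i + 1)) (pow_mem (derOp_mem K) (j + 1)))

/-- `e_{ij}` as an element of the ring `I₁`. -/
def eI (i j : ℕ) : I1 K := ⟨eOp K i j, eOp_mem K i j⟩

/-- `∂` as an element of the ring `I₁`. -/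
def derI : I1 K := ⟨derOp K, derOp_mem K⟩

/-- `∫` as an element of the ring `I₁`. -/
def intI : I1 K := ⟨intOp K, intOp_mem K⟩

/-- `H := ∂ ∘ x` (first multiply by `x`, then differentiate). -/
def hOp : Module.End K (Polynomial K) := derOp K * xOp K

/-- `K[H]`, the unital subalgebra of `I₁` generated by `H`. -/
def KH : Subalgebra K (Module.End K (Polynomial K)) := Algebra.adjoin K {hOp K}

/-- The action of `a ∈ I₁` on a left `I₁`-module `M`, as a `K`-linear map `a_M : M → M`. -/
def actMap (a : I1 K) (M : Type*) [AddCommGroup M] [Module (I1 K) M] [Module K M]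
    [SMulCommClass K (I1 K) M] : M →ₗ[K] M where
  toFun m := a • m
  map_add' := smul_add a
  map_smul' k m := (smul_comm k a m).symm

/-- Right multiplication `b ↦ b * a` in a ring `R`, as a homomorphism of left `R`-modules. -/
def rmulMap (R : Type*) [Ring R] (a : R) : R →ₗ[R] R where
  toFun b := b * a
  map_add' b c := add_mul b c a
  map_smul' c b := by simp [smul_eq_mul, mul_assoc]

/-- Left multiplication `b ↦ a * b` in a ring `R`, as a homomorphism of right `R`-modules
(i.e. of left `Rᵐᵒᵖ`-modules). -/
def lmulMap (R : Type*) [Ring R] (a : R) : R →ₗ[Rᵐᵒᵖ] R where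
  toFun b := a * b
  map_add' b c := mul_add a b c
  map_smul' c b := by simp [MulOpposite.smul_eq_mul_unop, mul_assoc]

/-- The centralizer `Cen_{I₁}(a) = {b ∈ I₁ : ab = ba}` of `a` in `I₁`, as a subalgebra of
`End_K(K[x])`. -/
def Cen (a : Module.End K (Polynomial K)) : Subalgebra K (Module.End K (Polynomial K)) :=
  I1 K ⊓ Subalgebra.centralizer K {a}

/-- `Cen_F(a) = {f ∈ F : af = fa}`, a `K`-subspace of `End_K(K[x])`. -/
def CenF (a : Module.End K (Polynomial K)) : Submodule K (Module.End K (Polynomial K)) :=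
  Fset K ⊓ Subalgebra.toSubmodule (Subalgebra.centralizer K {a})

section Weyl

variable {K} {A M : Type*} [Ring A] [Algebra K A] [AddCommGroup M] [Module K M]

/-- The normally ordered expression `∑ p_j(X) Y^j` attached to `P = ∑ p_j s^j ∈ K[t][s]`. -/
def normalForm (X Y : A) (P : K[X][X]) : A :=
  P.eval₂ (aeval X : K[X] →ₐ[K] A).toRingHom Y

lemma normalForm_add (X Y : A) (P Q : K[X][X]) :
    normalForm X Y (P + Q) = normalForm X Y P + normalForm X Y Q :=
  eval₂_add _ _

lemma normalForm_sub (X Y : A) (P Q : K[X][X]) :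
    normalForm X Y (P - Q) = normalForm X Y P - normalForm X Y Q := by
  rw [eq_sub_iff_add_eq, ← normalForm_add, sub_add_cancel]

lemma normalForm_C (X Y : A) (p : K[X]) : normalForm X Y (C p) = aeval X p :=
  eval₂_C _ _

lemma normalForm_mul_X (X Y : A) (P : K[X][X]) :
    normalForm X Y (P * Polynomial.X) = normalForm X Y P * Y :=
  eval₂_mul_X _ _

lemma normalForm_C_mul (X Y : A) (p : K[X]) (P : K[X][X]) :
    normalForm X Y (C p * P) = aeval X p * normalForm X Y P := by
  induction P using Polynomial.induction_on' with
  | add P Q hP hQ => rw [mul_add, normalForm_add, normalForm_add, hP, hQ, mul_add]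
  | monomial n q => simp [normalForm, C_mul_monomial, eval₂_monomial, mul_assoc]

lemma normalForm_monomial (X Y : A) (n : ℕ) (p : K[X]) :
    normalForm X Y (monomial n p) = aeval X p * Y ^ n :=
  eval₂_monomial _ _

lemma normalForm_X_pow (X Y : A) (n : ℕ) :
    normalForm X Y ((Polynomial.X : K[X][X]) ^ n) = Y ^ n := by
  simp [normalForm]

lemma normalForm_eq_sum (X Y : A) (P : K[X][X]) :
    normalForm X Y P = ∑ j ∈ Finset.range (P.natDegree + 1), aeval X (P.coeff j) * Y ^ j :=
  eval₂_eq_sum_range _ _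

lemma map_normalForm {B : Type*} [Ring B] [Algebra K B] (φ : A →ₐ[K] B) (X Y : A) (P : K[X][X]) :
    φ (normalForm X Y P) = normalForm (φ X) (φ Y) P := by
  simp [normalForm_eq_sum, aeval_algHom_apply]

lemma mul_aeval_of_commutator {X Y : A} (h : Y * X = X * Y + 1) (p : K[X]) :
    Y * aeval X p = aeval X p * Y + aeval X (derivative p) := by
  induction p using Polynomial.induction_on with
  | C a => simp [Algebra.commutes]
  | add p q hp hq => simp only [map_add, mul_add, add_mul, hp, hq]; abel
  | monomial n a ih =>
    have e : (C a * Polynomial.X ^ (n + 1) : K[X]) = C a * Polynomial.X ^ n * Polynomial.X := by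
      rw [pow_succ, mul_assoc]
    rw [e, map_mul, ← mul_assoc, ih, aeval_X, derivative_mul (g := Polynomial.X), derivative_X,
      add_mul, mul_assoc, h]
    simp only [map_add, map_mul, aeval_X, mul_add, mul_one]
    simp only [mul_assoc]
    abel

/-- Formal counterpart of multiplication on the left by `Y`. -/
lemma exists_normalForm_left_mul {X Y : A} (h : Y * X = X * Y + 1) (P : K[X][X]) :
    ∃ Q : K[X][X], Y * normalForm X Y P = normalForm X Y Q := by
  induction P using Polynomial.induction_on' with
  | add P Q hP hQ =>
    obtain ⟨P', hP⟩ := hP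
    obtain ⟨Q', hQ⟩ := hQ
    exact ⟨P' + Q', by rw [normalForm_add, normalForm_add, mul_add, hP, hQ]⟩
  | monomial n p =>
    refine ⟨monomial (n + 1) p + monomial n (derivative p), ?_⟩
    rw [normalForm_add]
    simp only [normalForm_monomial]
    rw [← mul_assoc, mul_aeval_of_commutator h, add_mul, mul_assoc, ← pow_succ']

lemma exists_normalForm_of_mem_adjoin {X Y : A} (h : Y * X = X * Y + 1) {a : A}
    (ha : a ∈ Algebra.adjoin K {X, Y}) : ∃ P : K[X][X], a = normalForm X Y P := by
  suffices H : ∀ P : K[X][X], ∃ Q, a * normalForm X Y P = normalForm X Y Q by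
    obtain ⟨Q, hQ⟩ := H 1
    exact ⟨Q, by simpa [normalForm] using hQ⟩
  induction ha using Algebra.adjoin_induction with
  | mem x hx =>
    rcases hx with rfl | rfl
    · intro P
      exact ⟨C Polynomial.X * P, by rw [normalForm_C_mul, aeval_X]⟩
    · exact exists_normalForm_left_mul h
  | algebraMap r =>
    intro P
    exact ⟨C (C r) * P, by rw [normalForm_C_mul, aeval_C]⟩
  | add a b _ _ ha hb =>
    intro P
    obtain ⟨Q, hQ⟩ := ha P
    obtain ⟨R, hR⟩ := hb P
    exact ⟨Q + R, by rw [add_mul, hQ, hR, normalForm_add]⟩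
  | mul a b _ _ ha hb =>
    intro P
    obtain ⟨Q, hQ⟩ := hb P
    obtain ⟨R, hR⟩ := ha Q
    exact ⟨R, by rw [mul_assoc, hQ, hR]⟩

lemma normalForm_mem_adjoin (X Y : A) (P : K[X][X]) :
    normalForm X Y P ∈ Algebra.adjoin K {X, Y} := by
  have hX : X ∈ Algebra.adjoin K {X, Y} := Algebra.subset_adjoin (by simp)
  have hY : Y ∈ Algebra.adjoin K {X, Y} := Algebra.subset_adjoin (by simp)
  rw [normalForm_eq_sum]
  refine sum_mem fun j _ => mul_mem ?_ (pow_mem hY j)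
  have := (aeval (⟨X, hX⟩ : Algebra.adjoin K {X, Y}) (P.coeff j)).2
  rwa [← Subalgebra.coe_val, ← aeval_algHom_apply] at this

/-- An increasing exhaustive filtration of `M` of at most linear growth, shifted by at most one
by `X` and `Y`. -/
def HasLinearGrowth (X Y : Module.End K M) : Prop :=
  ∃ (F : ℕ → Submodule K M) (c : ℕ), Monotone F ∧ (∀ n, FiniteDimensional K (F n)) ∧
    (∀ n, Module.finrank K (F n) ≤ c * (n + 1)) ∧ (∀ m, ∃ n, m ∈ F n) ∧
    ∀ n, ∀ m ∈ F n, X m ∈ F (n + 1) ∧ Y m ∈ F (n + 1)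

lemma HasLinearGrowth.symm_neg {X Y : Module.End K M} (h : HasLinearGrowth X Y) :
    HasLinearGrowth Y (-X) := by
  obtain ⟨F, c, h1, h2, h3, h4, h5⟩ := h
  exact ⟨F, c, h1, h2, h3, h4, fun n m hm => ⟨(h5 n m hm).2, neg_mem (h5 n m hm).1⟩⟩

section Filtration

variable {F : ℕ → Submodule K M}

lemma pow_apply_mem_filtration {Z : Module.End K M} (hZ : ∀ n, ∀ m ∈ F n, Z m ∈ F (n + 1))
    (i : ℕ) {n : ℕ} {m : M} (hm : m ∈ F n) : (Z ^ i) m ∈ F (n + i) := by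
  induction i with
  | zero => simpa using hm
  | succ i ih => rw [pow_succ', Module.End.mul_apply]; exact hZ _ _ ih

lemma aeval_apply_mem_filtration {Z : Module.End K M} (hF : Monotone F)
    (hZ : ∀ n, ∀ m ∈ F n, Z m ∈ F (n + 1))
    {p : K[X]} {d : ℕ} (hp : p.natDegree ≤ d) {n : ℕ} {m : M} (hm : m ∈ F n) :
    aeval Z p m ∈ F (n + d) := by
  rw [aeval_eq_sum_range' (Nat.lt_succ_of_le hp), LinearMap.sum_apply]
  refine sum_mem fun i hi => ?_
  rw [LinearMap.smul_apply]
  refine Submodule.smul_mem _ _ (hF ?_ (pow_apply_mem_filtration hZ i hm))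
  have := Finset.mem_range.1 hi
  omega

lemma exists_normalForm_shift {X Y : Module.End K M} (hF : Monotone F)
    (hXY : ∀ n, ∀ m ∈ F n, X m ∈ F (n + 1) ∧ Y m ∈ F (n + 1)) (P : K[X][X]) :
    ∃ k, ∀ n, ∀ m ∈ F n, normalForm X Y P m ∈ F (n + k) := by
  refine ⟨P.natDegree + (Finset.range (P.natDegree + 1)).sup fun j => (P.coeff j).natDegree,
    fun n m hm => ?_⟩
  rw [normalForm_eq_sum, LinearMap.sum_apply]
  refine sum_mem fun j hj => ?_
  rw [Module.End.mul_apply]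
  have h1 := pow_apply_mem_filtration (fun n m hm => (hXY n m hm).2) j hm
  have h2 := aeval_apply_mem_filtration hF (fun n m hm => (hXY n m hm).1)
    (Finset.le_sup (f := fun j => (P.coeff j).natDegree) hj) h1
  refine hF ?_ h2
  have := Finset.mem_range.1 hj
  omega

end Filtration

/-- If `f' g = f g'` with `f ≠ 0`, then `g` is a constant multiple of `f`. -/
lemma exists_eq_C_mul_of_wronskian_eq_zero {f g : K[X]} (hf : f ≠ 0)
    (h : derivative f * g = f * derivative g) : ∃ c : K, g = C c * f := by
  classical
  obtain ⟨f', hf'⟩ := EuclideanDomain.gcd_dvd_left f g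
  obtain ⟨g', hg'⟩ := EuclideanDomain.gcd_dvd_right f g
  set d := EuclideanDomain.gcd f g with hd
  have hd0 : d ≠ 0 := by rintro h0; rw [h0, zero_mul] at hf'; exact hf hf'
  have hf'0 : f' ≠ 0 := by rintro rfl; rw [mul_zero] at hf'; exact hf hf'
  have hcop : IsCoprime f' g' := by
    have e : d = d * f' * EuclideanDomain.gcdA f g + d * g' * EuclideanDomain.gcdB f g := by
      rw [← hf', ← hg']
      exact EuclideanDomain.gcd_eq_gcd_ab f g
    refine ⟨EuclideanDomain.gcdA f g, EuclideanDomain.gcdB f g, mul_left_cancel₀ hd0 ?_⟩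
    linear_combination -e
  have hw : wronskian f' g' = 0 := by
    have e : derivative f * g - f * derivative g =
        d * d * (derivative f' * g' - f' * derivative g') := by
      rw [hf', hg']; simp only [derivative_mul]; ring
    rw [sub_eq_zero.2 h] at e
    have := (mul_eq_zero.1 e.symm).resolve_left (mul_ne_zero hd0 hd0)
    rw [wronskian]; linear_combination -this
  obtain ⟨h1, h2⟩ := hcop.wronskian_eq_zero_iff.1 hw
  obtain ⟨a, rfl⟩ := natDegree_eq_zero.1 (derivative_eq_zero.1 h1)
  obtain ⟨b, rfl⟩ := natDegree_eq_zero.1 (derivative_eq_zero.1 h2)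
  have ha : a ≠ 0 := by rintro rfl; simp at hf'0
  refine ⟨b / a, ?_⟩
  rw [hf', hg', mul_left_comm, ← C_mul, div_mul_cancel₀ _ ha]

end Weyl

section LinearGrowth

variable {K} {M : Type*} [AddCommGroup M] [Module K M]

lemma finiteDimensional_of_linearIndependent_card_le {V : Type*} [AddCommGroup V] [Module K V]
    (n : ℕ) (H : ∀ s : Finset V, (LinearIndependent K fun i : s => (i : V)) → s.card ≤ n) :
    FiniteDimensional K V :=
  Module.rank_lt_aleph0_iff.1 ((_root_.rank_le H).trans_lt (Cardinal.natCast_lt_aleph0))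

/-- A Wronskian argument: vectors killed by a differential operator and independent over `K`
satisfy no nontrivial relation over `K[X]` that is shared by their derivatives. -/
lemma eq_zero_of_relation {X Y : Module.End K M} (h : Y * X = X * Y + 1)
    (htf : ∀ (p : K[X]) (m : M), aeval X p m = 0 → p = 0 ∨ m = 0) {P : K[X][X]}
    (hP : 0 < P.natDegree) {ι : Type*} (v : ι → M) (hv : LinearIndependent K v)
    (hker : ∀ i, normalForm X Y P (v i) = 0) (s : Finset ι) :
    ∀ f : ι → K[X], (∀ j < P.natDegree, ∑ i ∈ s, aeval X (f i) ((Y ^ j) (v i)) = 0) →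
      ∀ i ∈ s, f i = 0 := by
  classical
  induction s using Finset.induction_on with
  | empty => simp
  | insert a s ha ih =>
    intro f hf
    have key : ∀ p : K[X], ∀ j, ∀ g : ι → K[X],
        ∑ i ∈ insert a s, aeval X (p * g i) ((Y ^ j) (v i)) =
          aeval X p (∑ i ∈ insert a s, aeval X (g i) ((Y ^ j) (v i))) := by
      intro p j g
      simp [map_sum]
    have htop : ∑ i ∈ insert a s, aeval X (f i) ((Y ^ P.natDegree) (v i)) = 0 := by
      have hlead : P.leadingCoeff ≠ 0 := by
        rw [Ne, leadingCoeff_eq_zero]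
        rintro rfl
        simp at hP
      refine (htf P.leadingCoeff _ ?_).resolve_left hlead
      rw [← key]
      have : ∀ i, aeval X (P.leadingCoeff * f i) ((Y ^ P.natDegree) (v i)) =
          - ∑ j ∈ Finset.range P.natDegree, aeval X (P.coeff j * f i) ((Y ^ j) (v i)) := by
        intro i
        have e := congrArg (aeval X (f i)) (hker i)
        rw [normalForm_eq_sum, Finset.sum_range_succ, map_zero, LinearMap.add_apply,
          LinearMap.sum_apply, map_add, map_sum] at e
        rw [eq_neg_iff_add_eq_zero, add_comm]
        convert e using 2
        · refine Finset.sum_congr rfl fun j _ => ?_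
          rw [mul_comm, map_mul, Module.End.mul_apply, Module.End.mul_apply]
        · rw [mul_comm, map_mul, Module.End.mul_apply, Module.End.mul_apply]; rfl
      simp only [this]
      rw [Finset.sum_neg_distrib, Finset.sum_comm, neg_eq_zero]
      refine Finset.sum_eq_zero fun j hj => ?_
      rw [key, hf j (Finset.mem_range.1 hj), map_zero]
    have hall : ∀ j ≤ P.natDegree, ∑ i ∈ insert a s, aeval X (f i) ((Y ^ j) (v i)) = 0 := by
      intro j hj
      rcases hj.lt_or_eq with hj | rfl
      · exact hf j hj
      · exact htop
    have hder : ∀ j < P.natDegree,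
        ∑ i ∈ insert a s, aeval X (derivative (f i)) ((Y ^ j) (v i)) = 0 := by
      intro j hj
      have e := congrArg Y (hf j hj)
      rw [map_sum, map_zero] at e
      have e2 : ∀ i, Y (aeval X (f i) ((Y ^ j) (v i))) =
          aeval X (f i) ((Y ^ (j + 1)) (v i)) + aeval X (derivative (f i)) ((Y ^ j) (v i)) := by
        intro i
        have := LinearMap.congr_fun (mul_aeval_of_commutator h (f i)) ((Y ^ j) (v i))
        simpa [pow_succ'] using this
      simpa [e2, Finset.sum_add_distrib, hall (j + 1) hj] using e
    set g : ι → K[X] := fun l => derivative (f a) * f l - f a * derivative (f l) with hg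
    have hga : g a = 0 := by simp only [hg]; ring
    have hgs : ∀ l ∈ insert a s, g l = 0 := by
      intro l hl
      rcases Finset.mem_insert.1 hl with rfl | hl
      · exact hga
      · refine ih g (fun j hj => ?_) l hl
        have : ∑ i ∈ insert a s, aeval X (g i) ((Y ^ j) (v i)) = 0 := by
          simp only [hg, map_sub, LinearMap.sub_apply, Finset.sum_sub_distrib]
          rw [key, key, hf j hj, hder j hj]
          simp
        rwa [Finset.sum_insert ha, hga, map_zero, LinearMap.zero_apply, zero_add] at this
    have hfa : f a = 0 := by
      by_contra hfa
      have hc : ∀ l, ∃ c : K, l ∈ insert a s → f l = C c * f a := by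
        intro l
        by_cases hl : l ∈ insert a s
        · obtain ⟨c, hc⟩ := exists_eq_C_mul_of_wronskian_eq_zero hfa (sub_eq_zero.1 (hgs l hl))
          exact ⟨c, fun _ => hc⟩
        · exact ⟨0, fun h => absurd h hl⟩
      choose c hc using hc
      have e := hf 0 hP
      have e2 : ∑ i ∈ insert a s, aeval X (f a * C (c i)) ((Y ^ 0) (v i)) = 0 := by
        rw [← e]
        exact Finset.sum_congr rfl fun l hl => by rw [hc l hl, mul_comm]
      rw [key] at e2
      have e3 := (htf _ _ e2).resolve_left hfa
      have := linearIndependent_iff'.1 hv (insert a s) c (by simpa using e3) a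
        (Finset.mem_insert_self a s)
      have e4 := hc a (Finset.mem_insert_self a s)
      rw [this, map_zero, zero_mul] at e4
      exact hfa e4
    intro i hi
    rcases Finset.mem_insert.1 hi with rfl | hi
    · exact hfa
    · refine ih f (fun j hj => ?_) i hi
      have := hf j hj
      rwa [Finset.sum_insert ha, hfa, map_zero, LinearMap.zero_apply, zero_add] at this

/-- If `M` has linear growth, sufficiently many finite tuples of vectors satisfy a common
nontrivial relation over `K[X]`. -/
lemma HasLinearGrowth.exists_relation {X Y : Module.End K M} (hgr : HasLinearGrowth X Y) (d : ℕ) :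
    ∃ B : ℕ, ∀ (ι : Type _) [Fintype ι] (w : ι → Fin d → M), B < Fintype.card ι →
      ∃ f : ι → K[X], f ≠ 0 ∧ ∀ j, ∑ i, aeval X (f i) (w i j) = 0 := by
  classical
  obtain ⟨F, c, hmono, hfin, hdim, hex, hXY⟩ := hgr
  refine ⟨d * c, fun ι _ w hB => ?_⟩
  choose t ht using hex
  let s : ℕ := Finset.univ.sup fun i => Finset.univ.sup fun j => t (w i j)
  have hs : ∀ i j, w i j ∈ F s := fun i j => by
    refine hmono ?_ (ht (w i j))
    exact (Finset.le_sup (f := fun j => t (w i j)) (Finset.mem_univ j)).trans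
      (Finset.le_sup (f := fun i => Finset.univ.sup fun j => t (w i j)) (Finset.mem_univ i))
  let N : ℕ := d * c * (s + 1) + 1
  let E : (Fin N → K) →ₗ[K] K[X] := (degreeLT K N).subtype ∘ₗ (degreeLTEquiv K N).symm.toLinearMap
  have hE : Function.Injective E := by
    intro x y hxy
    exact (degreeLTEquiv K N).symm.injective (Subtype.ext hxy)
  have hEdeg : ∀ x, (E x).natDegree ≤ N := fun x => by
    have := mem_degreeLT.1 ((degreeLTEquiv K N).symm x).2
    exact natDegree_le_of_degree_le this.le
  let L0 : Fin d → (ι → Fin N → K) →ₗ[K] M := fun j =>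
    ∑ i, (LinearMap.applyₗ (w i j)) ∘ₗ (aeval X).toLinearMap ∘ₗ E ∘ₗ LinearMap.proj i
  have hL0 : ∀ j x, L0 j x = ∑ i, aeval X (E (x i)) (w i j) := fun j x => by
    simp [L0, LinearMap.sum_apply]
  have hL0mem : ∀ j x, L0 j x ∈ F (s + N) := fun j x => by
    rw [hL0]
    exact sum_mem fun i _ =>
      aeval_apply_mem_filtration hmono (fun n m hm => (hXY n m hm).1) (hEdeg _) (hs i j)
  let L : (ι → Fin N → K) →ₗ[K] (Fin d → F (s + N)) :=
    LinearMap.pi fun j => (L0 j).codRestrict (F (s + N)) (hL0mem j)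
  have hlt : Module.finrank K (Fin d → F (s + N)) < Module.finrank K (ι → Fin N → K) := by
    have h1 := hdim (s + N)
    have e1 : Module.finrank K (Fin d → F (s + N)) = d * Module.finrank K (F (s + N)) := by
      rw [Module.finrank_pi_fintype]; simp
    have e2 : Module.finrank K (ι → Fin N → K) = Fintype.card ι * N := by
      rw [Module.finrank_pi_fintype]; simp
    rw [e1, e2]
    calc d * Module.finrank K (F (s + N)) ≤ d * (c * (s + N + 1)) := Nat.mul_le_mul_left _ h1
      _ = d * c * (s + 1) + d * c * N := by ring
      _ < N + d * c * N := by simp only [N]; omega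
      _ = (d * c + 1) * N := by ring
      _ ≤ _ := Nat.mul_le_mul_right _ hB
  obtain ⟨x, hx, hx0⟩ := Submodule.exists_mem_ne_zero_of_ne_bot
    (LinearMap.ker_ne_bot_of_finrank_lt (f := L) hlt)
  refine ⟨fun i => E (x i), fun h0 => hx0 ?_, fun j => ?_⟩
  · funext i
    exact hE ((congrFun h0 i).trans (map_zero E).symm)
  · have := congrArg Subtype.val (congrFun (LinearMap.mem_ker.1 hx) j)
    rw [← hL0]
    exact this

/-- Solution spaces of differential operators on torsion-free modules of linear growth are
finite-dimensional. -/
theorem finiteDimensional_ker_normalForm {X Y : Module.End K M} (h : Y * X = X * Y + 1)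
    (hgr : HasLinearGrowth X Y)
    (htf : ∀ (p : K[X]) (m : M), aeval X p m = 0 → p = 0 ∨ m = 0) {P : K[X][X]} (hP : P ≠ 0) :
    FiniteDimensional K (LinearMap.ker (normalForm X Y P)) := by
  rcases Nat.eq_zero_or_pos P.natDegree with h0 | hpos
  · obtain ⟨p, rfl⟩ := natDegree_eq_zero.1 h0
    have hp : p ≠ 0 := by rintro rfl; simp at hP
    have : LinearMap.ker (normalForm X Y (C p)) = ⊥ := by
      rw [LinearMap.ker_eq_bot']
      intro m hm
      rw [normalForm_C] at hm
      exact (htf p m hm).resolve_left hp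
    rw [this]
    infer_instance
  · obtain ⟨B, hB⟩ := hgr.exists_relation P.natDegree
    refine finiteDimensional_of_linearIndependent_card_le B fun s hs => ?_
    by_contra hcard
    obtain ⟨f, hf0, hf⟩ := hB s (fun i j => (Y ^ (j : ℕ)) (i : M))
      (by simpa using hcard)
    apply hf0
    funext i
    have hv : LinearIndependent K fun i : s => ((i : LinearMap.ker (normalForm X Y P)) : M) :=
      hs.map' (LinearMap.ker (normalForm X Y P)).subtype (Submodule.ker_subtype _)
    exact eq_zero_of_relation h htf hpos _ hv (fun i => LinearMap.mem_ker.1 i.1.2) Finset.univ f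
      (fun j hj => hf ⟨j, hj⟩) i (Finset.mem_univ i)

/-- An operator of bounded degree with finite-dimensional kernel on a space with a filtration of
linear growth has finite-dimensional cokernel. -/
theorem finiteDimensional_coker_of_ker {X Y : Module.End K M} (hgr : HasLinearGrowth X Y)
    (P : K[X][X]) (hker : FiniteDimensional K (LinearMap.ker (normalForm X Y P))) :
    FiniteDimensional K (M ⧸ LinearMap.range (normalForm X Y P)) := by
  classical
  obtain ⟨F, c, hmono, hfin, hdim, hex, hXY⟩ := hgr
  obtain ⟨k, hk⟩ := exists_normalForm_shift hmono hXY P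
  set g := normalForm X Y P with hg
  refine finiteDimensional_of_linearIndependent_card_le
    (c * k + Module.finrank K (LinearMap.ker g)) fun s hs => ?_
  by_contra hcard
  set κ := Module.finrank K (LinearMap.ker g)
  let lift : M ⧸ LinearMap.range g → M := Function.surjInv (Submodule.mkQ_surjective _)
  have hlift : ∀ q, (LinearMap.range g).mkQ (lift q) = q :=
    Function.surjInv_eq (Submodule.mkQ_surjective _)
  choose t ht using hex
  let n₀ : ℕ := s.sup fun q => t (lift q)
  have hn₀ : ∀ q ∈ s, lift q ∈ F n₀ := fun q hq =>
    hmono (Finset.le_sup (f := fun q => t (lift q)) hq) (ht _)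
  have step : ∀ n, n₀ ≤ n → Module.finrank K (F n) + (c * k + 1) ≤
      Module.finrank K (F (n + k)) := by
    intro n hn
    let π : F (n + k) →ₗ[K] M ⧸ LinearMap.range g := (LinearMap.range g).mkQ.domRestrict _
    have h1 : s.card ≤ Module.finrank K (LinearMap.range π) := by
      have := finrank_span_finset_eq_card (R := K) hs
      rw [← this]
      refine Submodule.finrank_mono (Submodule.span_le.2 fun q hq => ?_)
      exact ⟨⟨lift q, hmono (by omega) (hn₀ q hq)⟩, hlift q⟩
    let g' : F n →ₗ[K] F (n + k) := (g.domRestrict (F n)).codRestrict _ fun m => hk n m m.2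
    have h2 : LinearMap.range g' ≤ LinearMap.ker π := by
      rintro _ ⟨m, rfl⟩
      rw [LinearMap.mem_ker]
      exact (Submodule.Quotient.mk_eq_zero _).2 ⟨m, rfl⟩
    have h3 := Submodule.finrank_mono h2
    have h4 := LinearMap.finrank_range_add_finrank_ker g'
    have h5 := LinearMap.finrank_range_add_finrank_ker π
    have h6 : Module.finrank K (LinearMap.ker g') ≤ κ := by
      let i : LinearMap.ker g' →ₗ[K] LinearMap.ker g :=
        ((F n).subtype ∘ₗ (LinearMap.ker g').subtype).codRestrict _ fun m => by
          have := congrArg Subtype.val (LinearMap.mem_ker.1 m.2)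
          exact this
      refine LinearMap.finrank_le_finrank_of_injective (f := i) fun x y hxy => ?_
      exact Subtype.ext (Subtype.ext (congrArg (fun z : LinearMap.ker g => (z : M)) hxy))
    omega
  have grow : ∀ r : ℕ, r * (c * k + 1) ≤ Module.finrank K (F (n₀ + r * k)) := by
    intro r
    induction r with
    | zero => simp
    | succ r ih =>
      have := step (n₀ + r * k) (by omega)
      have e : n₀ + (r + 1) * k = n₀ + r * k + k := by ring
      rw [e, add_mul]
      omega
  have h1 := (grow (c * (n₀ + 1) + 1)).trans (hdim _)
  have h2 : c * (n₀ + (c * (n₀ + 1) + 1) * k + 1) =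
    c * (n₀ + 1) + (c * (n₀ + 1) + 1) * (c * k) := by ring
  rw [h2, mul_add] at h1
  omega

end LinearGrowth

section PolynomialOperators

variable {K}

lemma intOp_monomial (n : ℕ) (a : K) :
    intOp K (monomial n a) = monomial (n + 1) (a * ((n : K) + 1)⁻¹) := by
  have h : monomial n a = a • Polynomial.basisMonomials K n := by
    simp [coe_basisMonomials, smul_monomial]
  rw [h, map_smul, intOp, Module.Basis.constr_basis, ← monomial_one_right_eq_X_pow, smul_monomial,
    smul_monomial]
  simp

lemma derOp_mul_intOp : derOp K * intOp K = 1 := by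
  refine LinearMap.ext fun f => ?_
  induction f using Polynomial.induction_on' with
  | add p q hp hq => rw [map_add, map_add, hp, hq]
  | monomial n a =>
    rw [Module.End.mul_apply, intOp_monomial, derOp, derivative_monomial]
    have : (n : K) + 1 ≠ 0 := by exact_mod_cast Nat.succ_ne_zero n
    simp [this]

lemma derOp_mul_xOp : derOp K * xOp K = xOp K * derOp K + 1 := by
  refine LinearMap.ext fun f => ?_
  simp [derOp, xOp, derivative_mul, add_comm]

lemma intOp_derOp_apply (f : K[X]) : intOp K (derOp K f) = f - C (f.coeff 0) := by
  induction f using Polynomial.induction_on' with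
  | add p q hp hq => rw [map_add, map_add, hp, hq, coeff_add, map_add]; ring
  | monomial n a =>
    rw [derOp, derivative_monomial, intOp_monomial]
    cases n with
    | zero => simp
    | succ n =>
      have : (n : K) + 1 ≠ 0 := by exact_mod_cast Nat.succ_ne_zero n
      simp [this, coeff_monomial]

lemma intOp_mul_derOp_mul_xOp : intOp K * (derOp K * xOp K) = xOp K := by
  refine LinearMap.ext fun f => ?_
  rw [Module.End.mul_apply, Module.End.mul_apply, intOp_derOp_apply]
  simp [xOp]

lemma eOp_zero_apply (f : K[X]) : eOp K 0 0 f = C (f.coeff 0) := by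
  simp [eOp, intOp_derOp_apply]

lemma aeval_xOp_apply (p f : K[X]) : aeval (xOp K) p f = p * f := by
  have h : xOp K = Algebra.lmul K K[X] Polynomial.X := rfl
  rw [h, aeval_algHom_apply, aeval_X_left_apply]
  rfl

lemma hasLinearGrowth_polynomial : HasLinearGrowth (xOp K) (derOp K) := by
  have hmem : ∀ (n : ℕ) (f : K[X]), f ∈ degreeLT K (n + 1) ↔ f.natDegree ≤ n := fun n f => by
    rw [degreeLT_succ_eq_degreeLE, mem_degreeLE, natDegree_le_iff_degree_le]
  refine ⟨fun n => degreeLT K (n + 1), 1, fun m n h => degreeLT_mono (by omega), fun n =>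
    LinearEquiv.finiteDimensional (degreeLTEquiv K (n + 1)).symm, fun n => ?_,
    fun f => ⟨f.natDegree, (hmem _ _).2 le_rfl⟩, fun n f hf => ?_⟩
  · rw [(degreeLTEquiv K (n + 1)).finrank_eq]
    simp
  · rw [hmem] at hf
    rw [hmem, hmem]
    refine ⟨natDegree_mul_le.trans ?_, (natDegree_derivative_le f).trans (by omega)⟩
    rw [natDegree_X]
    omega

lemma finiteDimensional_ker_polynomial {P : K[X][X]} (hP : P ≠ 0) :
    FiniteDimensional K (LinearMap.ker (normalForm (xOp K) (derOp K) P)) := by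
  refine finiteDimensional_ker_normalForm derOp_mul_xOp hasLinearGrowth_polynomial ?_ hP
  intro p m h
  rwa [aeval_xOp_apply, mul_eq_zero] at h

lemma not_finiteDimensional_polynomial : ¬ FiniteDimensional K K[X] := Polynomial.not_finite

/-- If both factors have finite-dimensional kernel, then the product is nonzero. -/
lemma mul_ne_zero_of_finiteDimensional_ker {V : Type*} [AddCommGroup V] [Module K V]
    (hV : ¬ FiniteDimensional K V) {f g : Module.End K V}
    (hf : FiniteDimensional K (LinearMap.ker f)) (hg : FiniteDimensional K (LinearMap.ker g)) :
    f * g ≠ 0 := by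
  intro h
  apply hV
  have h1 : LinearMap.range g ≤ LinearMap.ker f := by
    rintro _ ⟨v, rfl⟩
    exact LinearMap.congr_fun h v
  have h2 : FiniteDimensional K (LinearMap.range g) := Submodule.finiteDimensional_of_le h1
  refine ⟨Submodule.fg_of_fg_map_of_fg_inf_ker g ?_ ?_⟩
  · rw [← LinearMap.range_eq_map]
    exact Module.Finite.iff_fg.1 h2
  · rw [top_inf_eq]
    exact Module.Finite.iff_fg.1 hg

end PolynomialOperators

section IntegroDifferential

variable {K}

/-- Multiplication by `x` as an element of the ring `I₁`. -/
def xI : I1 K := ⟨xOp K, xOp_mem K⟩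

lemma derI_mul_xI : derI K * xI = xI * derI K + 1 := Subtype.ext derOp_mul_xOp

lemma derI_mul_intI : derI K * intI K = 1 := Subtype.ext derOp_mul_intOp

lemma I1_induction {p : I1 K → Prop} (hx : p xI) (hd : p (derI K)) (hi : p (intI K))
    (hc : ∀ r : K, p (algebraMap K (I1 K) r)) (hadd : ∀ a b, p a → p b → p (a + b))
    (hmul : ∀ a b, p a → p b → p (a * b)) (a : I1 K) : p a := by
  obtain ⟨a, ha⟩ := a
  unfold I1 at ha
  induction ha using Algebra.adjoin_induction with
  | mem y hy =>
    rcases hy with rfl | rfl | rfl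
    exacts [hx, hd, hi]
  | algebraMap r => exact hc r
  | add a b _ _ ha hb => exact hadd _ _ ha hb
  | mul a b _ _ ha hb => exact hmul _ _ ha hb

lemma coe_normalForm (P : K[X][X]) :
    ((normalForm xI (derI K) P : I1 K) : Module.End K K[X]) =
      normalForm (xOp K) (derOp K) P :=
  map_normalForm (I1 K).val xI (derI K) P

lemma normalForm_mul_ne_zero {P Q : K[X][X]} (hP : P ≠ 0) (hQ : Q ≠ 0) :
    normalForm xI (derI K) P * normalForm xI (derI K) Q ≠ 0 := by
  intro h
  have := congrArg (fun a : I1 K => (a : Module.End K K[X])) h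
  simp only [MulMemClass.coe_mul, coe_normalForm] at this
  exact mul_ne_zero_of_finiteDimensional_ker not_finiteDimensional_polynomial
    (finiteDimensional_ker_polynomial hP) (finiteDimensional_ker_polynomial hQ) this

lemma pow_mul_of_commutator {A : Type*} [Ring A] {X Y : A} (h : Y * X = X * Y + 1) (n : ℕ) :
    Y ^ (n + 1) * X = X * Y ^ (n + 1) + (n + 1) • Y ^ n := by
  induction n with
  | zero => simpa using h
  | succ n ih =>
    rw [pow_succ', mul_assoc, ih, mul_add, ← mul_assoc, h, add_mul, mul_assoc, ← pow_succ',
      one_mul, mul_smul_comm, ← pow_succ', add_assoc, succ_nsmul' _ (n + 1)]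

/-- Left Ore-type condition: every element of the algebra generated by `X`, `Y` and a right
inverse `J` of `Y` becomes normally ordered after multiplication by a power of `Y` on the left. -/
lemma exists_pow_mul_eq_mul_pow {A : Type*} [Ring A] [Algebra K A] {X Y J : A}
    (h : Y * X = X * Y + 1) (hJ : Y * J = 1) {a : A} (ha : a ∈ Algebra.adjoin K {X, Y, J}) :
    ∀ l : ℕ, ∃ (N : ℕ) (u : A), u ∈ Algebra.adjoin K {X, Y} ∧ Y ^ N * a = u * Y ^ l := by
  have hX : X ∈ Algebra.adjoin K {X, Y} := Algebra.subset_adjoin (by simp)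
  have hY : Y ∈ Algebra.adjoin K {X, Y} := Algebra.subset_adjoin (by simp)
  induction ha using Algebra.adjoin_induction with
  | mem z hz =>
    intro l
    rcases hz with rfl | rfl | rfl
    · refine ⟨l + 1, z * Y + (l + 1) • 1,
        add_mem (mul_mem hX hY) (nsmul_mem (one_mem _) _), ?_⟩
      rw [pow_mul_of_commutator h, add_mul, mul_assoc, ← pow_succ', smul_mul_assoc, one_mul]
    · exact ⟨l, z, hY, by rw [← pow_succ, pow_succ']⟩
    · exact ⟨l + 1, 1, one_mem _, by rw [pow_succ, mul_assoc, hJ, mul_one, one_mul]⟩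
  | algebraMap r =>
    exact fun l => ⟨l, algebraMap K _ r, algebraMap_mem _ r, (Algebra.commutes r _).symm⟩
  | add a b _ _ ha hb =>
    intro l
    obtain ⟨N, u, hu, hN⟩ := ha l
    obtain ⟨N', u', hu', hN'⟩ := hb l
    refine ⟨N + N', Y ^ N' * u + Y ^ N * u',
      add_mem (mul_mem (pow_mem hY _) hu) (mul_mem (pow_mem hY _) hu'), ?_⟩
    rw [mul_add, add_mul, mul_assoc _ u, ← hN, mul_assoc _ u', ← hN', ← mul_assoc, ← mul_assoc,
      ← pow_add, ← pow_add, add_comm N' N]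
  | mul a b _ _ ha hb =>
    intro l
    obtain ⟨N, u, hu, hN⟩ := hb l
    obtain ⟨N', u', hu', hN'⟩ := ha N
    exact ⟨N', u' * u, mul_mem hu' hu, by rw [← mul_assoc, hN', mul_assoc, hN, mul_assoc]⟩

lemma exists_pow_derI_mul_eq_normalForm (a : I1 K) :
    ∃ (N : ℕ) (P : K[X][X]), derI K ^ N * a = normalForm xI (derI K) P := by
  obtain ⟨N, u, hu, h⟩ := exists_pow_mul_eq_mul_pow derOp_mul_xOp derOp_mul_intOp a.2 0
  obtain ⟨P, hP⟩ := exists_normalForm_of_mem_adjoin derOp_mul_xOp hu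
  refine ⟨N, P, Subtype.ext ?_⟩
  rw [coe_normalForm, ← hP, ← mul_one u, ← pow_zero (derOp K), ← h]
  rfl

lemma eOp_eq_mul (i j : ℕ) : eOp K i j = intOp K ^ i * eOp K 0 0 * derOp K ^ j := by
  simp only [eOp, pow_zero, zero_add, pow_one, mul_one]
  rw [mul_sub, sub_mul, mul_one, pow_succ, pow_succ' (derOp K)]
  simp only [mul_assoc]

lemma mul_mem_Fset (a : I1 K) : ∀ f ∈ Fset K, f * (a : Module.End K K[X]) ∈ Fset K := by
  have hgen : ∀ s : Module.End K K[X], (∀ i j, eOp K i j * s ∈ Fset K) →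
      ∀ f ∈ Fset K, f * s ∈ Fset K := by
    intro s hs f hf
    induction hf using Submodule.span_induction with
    | mem y hy =>
      obtain ⟨i, j, rfl⟩ := hy
      exact hs i j
    | zero => rw [zero_mul]; exact zero_mem _
    | add y z _ _ hy hz => rw [add_mul]; exact add_mem hy hz
    | smul r y _ hy => rw [smul_mul_assoc]; exact Submodule.smul_mem _ _ hy
  have he : ∀ i j, eOp K i j ∈ Fset K := fun i j => Submodule.subset_span ⟨i, j, rfl⟩
  have hex : eOp K 0 0 * xOp K = 0 := by
    simp [eOp, sub_mul, mul_assoc, intOp_mul_derOp_mul_xOp]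
  have hei : eOp K 0 0 * intOp K = 0 := by
    simp [eOp, sub_mul, mul_assoc, derOp_mul_intOp]
  induction a using I1_induction with
  | hx =>
    refine hgen _ fun i j => ?_
    change eOp K i j * xOp K ∈ _
    rw [eOp_eq_mul]
    cases j with
    | zero => rw [pow_zero, mul_one, mul_assoc, hex, mul_zero]; exact zero_mem _
    | succ j =>
      rw [mul_assoc, pow_mul_of_commutator derOp_mul_xOp, mul_add, ← mul_assoc,
        mul_assoc _ _ (xOp K),
        hex, mul_zero, zero_mul, zero_add]
      rw [mul_smul_comm, ← eOp_eq_mul]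
      exact nsmul_mem (he i j) _
  | hd =>
    refine hgen _ fun i j => ?_
    change eOp K i j * derOp K ∈ _
    rw [eOp_eq_mul, mul_assoc, ← pow_succ, ← eOp_eq_mul]
    exact he _ _
  | hi =>
    refine hgen _ fun i j => ?_
    change eOp K i j * intOp K ∈ _
    rw [eOp_eq_mul]
    cases j with
    | zero => rw [pow_zero, mul_one, mul_assoc, hei, mul_zero]; exact zero_mem _
    | succ j =>
      rw [mul_assoc, pow_succ, mul_assoc (derOp K ^ j), derOp_mul_intOp, mul_one, ← eOp_eq_mul]
      exact he _ _
  | hc r =>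
    intro f hf
    have : f * (algebraMap K (I1 K) r : Module.End K K[X]) = r • f := by
      rw [Algebra.smul_def, Algebra.commutes]
      rfl
    rw [this]
    exact Submodule.smul_mem _ _ hf
  | hadd a b ha hb =>
    intro f hf
    rw [AddMemClass.coe_add, mul_add]
    exact add_mem (ha f hf) (hb f hf)
  | hmul a b ha hb =>
    intro f hf
    rw [MulMemClass.coe_mul, ← mul_assoc]
    exact hb _ (ha f hf)

lemma one_sub_mem_Fset (k : ℕ) : 1 - intOp K ^ k * derOp K ^ k ∈ Fset K := by
  induction k with
  | zero => simp
  | succ k ih =>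
    have : 1 - intOp K ^ (k + 1) * derOp K ^ (k + 1) =
        (1 - intOp K ^ k * derOp K ^ k) + eOp K k k := by
      rw [eOp]; abel
    rw [this]
    exact add_mem ih (Submodule.subset_span ⟨k, k, rfl⟩)

lemma mem_Fset_of_pow_derI_mul_eq_zero {a : I1 K} {N : ℕ} (h : derI K ^ N * a = 0) :
    (a : Module.End K K[X]) ∈ Fset K := by
  have h' : derOp K ^ N * (a : Module.End K K[X]) = 0 := congrArg Subtype.val h
  have := mul_mem_Fset a _ (one_sub_mem_Fset N)
  rwa [sub_mul, mul_assoc, h', mul_zero, sub_zero, one_mul] at this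

lemma eI_zero_eq : eI K 0 0 = 1 - intI K * derI K := by
  refine Subtype.ext ?_
  simp [eI, eOp, intI, derI]

lemma exists_eI_mul_mul_eI (b : I1 K) : ∃ r : K, eI K 0 0 * b * eI K 0 0 = r • eI K 0 0 := by
  refine ⟨((b : Module.End K K[X]) 1).coeff 0, Subtype.ext (LinearMap.ext fun f => ?_)⟩
  change eOp K 0 0 ((b : Module.End K K[X]) (eOp K 0 0 f)) =
    ((b : Module.End K K[X]) 1).coeff 0 • eOp K 0 0 f
  have hC : (C (f.coeff 0) : K[X]) = f.coeff 0 • 1 := by rw [smul_eq_C_mul, mul_one]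
  rw [eOp_zero_apply f, hC, map_smul, map_smul, eOp_zero_apply, smul_comm, smul_eq_C_mul,
    smul_eq_C_mul, smul_eq_C_mul, mul_one]

end IntegroDifferential

section Torsion

variable {K} {M : Type*} [AddCommGroup M] [Module K M]

/-- A vector that is torsion for both `X` and `Y` with `[Y, X] = 1` vanishes. -/
lemma eq_zero_of_torsion {X Y : Module.End K M} (h : Y * X = X * Y + 1) {p q : K[X]}
    (hp : p ≠ 0) (hq : q ≠ 0) {m : M} (hpm : aeval X p m = 0) (hqm : aeval Y q m = 0) :
    m = 0 := by
  have hcomm : ∀ (f : K[X]) (u : M),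
      aeval X f (Y u) = Y (aeval X f u) - aeval X (derivative f) u := by
    intro f u
    have := LinearMap.congr_fun (mul_aeval_of_commutator h f) u
    simp only [Module.End.mul_apply, LinearMap.add_apply] at this
    rw [this, add_sub_cancel_right]
  have hpow : ∀ j : ℕ, aeval X (p ^ (j + 1)) ((Y ^ j) m) = 0 := by
    intro j
    induction j with
    | zero => simpa using hpm
    | succ j ih =>
      rw [pow_succ' Y, Module.End.mul_apply, hcomm, derivative_pow_succ]
      have e1 : aeval X (p ^ (j + 1 + 1)) ((Y ^ j) m) = 0 := by
        rw [pow_succ', map_mul, Module.End.mul_apply, ih, map_zero]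
      rw [e1, mul_right_comm, map_mul, Module.End.mul_apply, ih]
      simp
  have hkill : ∀ f : K[X], aeval X (p ^ (q.natDegree + 1)) (aeval Y f m) = 0 := by
    intro f
    have e : aeval Y f m = aeval Y (f % q) m := by
      conv_lhs => rw [← EuclideanDomain.mod_add_div f q, mul_comm q, map_add, map_mul]
      rw [LinearMap.add_apply, Module.End.mul_apply, hqm, map_zero, add_zero]
    have hdeg : (f % q).natDegree < q.natDegree + 1 :=
      Nat.lt_succ_of_le (natDegree_le_natDegree (EuclideanDomain.mod_lt f hq).le)
    rw [e, aeval_eq_sum_range' hdeg, LinearMap.sum_apply, map_sum]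
    refine Finset.sum_eq_zero fun j hj => ?_
    have hj' : q.natDegree + 1 = (q.natDegree - j) + (j + 1) := by
      have := Finset.mem_range.1 hj
      omega
    rw [LinearMap.smul_apply, map_smul, hj', pow_add, map_mul, Module.End.mul_apply, hpow,
      map_zero, smul_zero]
  have hmin : ∀ (n : ℕ) (P : K[X]), P.natDegree = n → P ≠ 0 →
      (∀ f : K[X], aeval X P (aeval Y f m) = 0) → m = 0 := by
    intro n
    induction n using Nat.strong_induction_on with
    | _ n ih =>
      intro P hn hP hPk
      rcases Nat.eq_zero_or_pos n with rfl | hpos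
      · obtain ⟨a, rfl⟩ := natDegree_eq_zero.1 hn
        have := hPk 1
        rw [map_one, Module.End.one_apply, aeval_C, Module.algebraMap_end_apply] at this
        exact (smul_eq_zero.1 this).resolve_left fun ha => hP (by rw [ha, map_zero])
      · refine ih _ (hn ▸ natDegree_derivative_lt (by omega)) (derivative P) rfl ?_ fun f => ?_
        · intro h0
          rw [derivative_eq_zero] at h0
          omega
        · have e := hcomm P (aeval Y f m)
          have e2 := hPk (Polynomial.X * f)
          rw [map_mul, aeval_X, Module.End.mul_apply] at e2
          rw [e2, hPk f, map_zero, zero_sub] at e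
          exact neg_eq_zero.1 e.symm
  exact hmin _ _ rfl (pow_ne_zero _ hp) hkill

lemma not_finiteDimensional_of_commutator [Nontrivial M] {X Y : Module.End K M}
    (h : Y * X = X * Y + 1) : ¬ FiniteDimensional K M := by
  intro hfin
  obtain ⟨m, hm⟩ := exists_ne (0 : M)
  refine hm (eq_zero_of_torsion h (minpoly.ne_zero (Algebra.IsIntegral.isIntegral X))
    (minpoly.ne_zero (Algebra.IsIntegral.isIntegral Y)) ?_ ?_) <;> simp [minpoly.aeval]

lemma rank_ker_pow_le {f : Module.End K M} (hf : Module.rank K (LinearMap.ker f) ≤ 1) (n : ℕ) :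
    Module.rank K (LinearMap.ker (f ^ n)) ≤ n := by
  induction n with
  | zero =>
    have : LinearMap.ker (f ^ 0) = ⊥ := by
      rw [pow_zero]
      exact LinearMap.ker_id
    rw [this]
    simp
  | succ n ih =>
    let g : LinearMap.ker (f ^ (n + 1)) →ₗ[K] LinearMap.ker (f ^ n) :=
      (f ∘ₗ (LinearMap.ker (f ^ (n + 1))).subtype).codRestrict _ fun m => by
        exact LinearMap.mem_ker.2
          ((LinearMap.congr_fun (pow_succ f n) (m : M)).symm.trans (LinearMap.mem_ker.1 m.2))
    let i : LinearMap.ker g →ₗ[K] LinearMap.ker f :=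
      ((LinearMap.ker (f ^ (n + 1))).subtype ∘ₗ (LinearMap.ker g).subtype).codRestrict _ fun m =>
        congrArg Subtype.val (LinearMap.mem_ker.1 m.2)
    have hi : Function.Injective i := fun x y hxy =>
      Subtype.ext (Subtype.ext (congrArg (fun z : LinearMap.ker f => (z : M)) hxy))
    rw [← LinearMap.rank_range_add_rank_ker g, Nat.cast_succ]
    exact add_le_add ((Submodule.rank_le _).trans ih)
      ((LinearMap.rank_le_of_injective i hi).trans hf)

end Torsion

/-- `X`, `Y` and `J` generate the `K`-algebra `R` and behave like multiplication by `x`,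
differentiation and integration. -/
structure IsIntegroDifferential {K R : Type*} [Field K] [Ring R] [Algebra K R] (X Y J : R) :
    Prop where
  commutator : Y * X = X * Y + 1
  right_inv : Y * J = 1
  induction : ∀ p : R → Prop, p X → p Y → p J → (∀ r : K, p (algebraMap K R r)) →
    (∀ a b, p a → p b → p (a + b)) → (∀ a b, p a → p b → p (a * b)) → ∀ a, p a
  corner : ∀ b, ∃ r : K, (1 - J * Y) * b * (1 - J * Y) = r • (1 - J * Y)
  mul_ne_zero : ∀ P Q : K[X][X], P ≠ 0 → Q ≠ 0 → normalForm X Y P * normalForm X Y Q ≠ 0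
  exists_pow_mul : ∀ a : R, ∃ (N : ℕ) (P : K[X][X]), Y ^ N * a = normalForm X Y P

section Boxes

variable {K} {R : Type*} [Ring R] [Algebra K R]

/-- The span of the monomials `X^i Y^j` with `i < p` and `j < q`. -/
def box (X Y : R) (p q : ℕ) : Submodule K R :=
  Submodule.span K (Set.range fun ij : Fin p × Fin q => X ^ (ij.1 : ℕ) * Y ^ (ij.2 : ℕ))

lemma pow_mul_pow_mem_box (X Y : R) {p q i j : ℕ} (hi : i < p) (hj : j < q) :
    X ^ i * Y ^ j ∈ box (K := K) X Y p q :=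
  Submodule.subset_span ⟨(⟨i, hi⟩, ⟨j, hj⟩), rfl⟩

lemma box_induction {X Y : R} {p q : ℕ} {S : Submodule K R}
    (h : ∀ i j, i < p → j < q → X ^ i * Y ^ j ∈ S) : box X Y p q ≤ S :=
  Submodule.span_le.2 <| by
    rintro _ ⟨ij, rfl⟩
    exact h _ _ ij.1.2 ij.2.2

lemma box_mono (X Y : R) {p q p' q' : ℕ} (hp : p ≤ p') (hq : q ≤ q') :
    box (K := K) X Y p q ≤ box X Y p' q' :=
  box_induction fun _ _ hi hj => pow_mul_pow_mem_box X Y (hi.trans_le hp) (hj.trans_le hq)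

instance (X Y : R) (p q : ℕ) : FiniteDimensional K (box (K := K) X Y p q) :=
  FiniteDimensional.span_of_finite K (Set.finite_range _)

lemma left_mul_mem_box (X Y : R) {p q : ℕ} {b : R} (hb : b ∈ box (K := K) X Y p q) :
    X * b ∈ box (K := K) X Y (p + 1) q := by
  have : box X Y p q ≤ (box X Y (p + 1) q).comap (LinearMap.mulLeft K X) :=
    box_induction fun i j hi hj => by
      rw [Submodule.mem_comap, LinearMap.mulLeft_apply, ← mul_assoc, ← pow_succ']
      exact pow_mul_pow_mem_box X Y (by omega) hj
  exact this hb

lemma left_mul_mem_box' {X Y : R} (h : Y * X = X * Y + 1) {p q : ℕ} {b : R}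
    (hb : b ∈ box (K := K) X Y p q) : Y * b ∈ box (K := K) X Y p (q + 1) := by
  have : box X Y p q ≤ (box X Y p (q + 1)).comap (LinearMap.mulLeft K Y) :=
    box_induction fun i j hi hj => by
      rw [Submodule.mem_comap, LinearMap.mulLeft_apply]
      have e := mul_aeval_of_commutator h (Polynomial.X ^ i : K[X])
      rw [map_pow, aeval_X] at e
      rw [← mul_assoc, e, add_mul, mul_assoc, ← pow_succ']
      refine add_mem (pow_mul_pow_mem_box X Y hi (by omega)) ?_
      rw [derivative_X_pow, map_mul, map_pow, aeval_X, aeval_C, ← Algebra.smul_def, smul_mul_assoc]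
      exact Submodule.smul_mem _ _ (pow_mul_pow_mem_box X Y (by omega) (by omega))
  exact this hb

lemma mul_mem_box {X Y : R} (h : Y * X = X * Y + 1) {p q k l : ℕ} {b c : R}
    (hb : b ∈ box (K := K) X Y p q) (hc : c ∈ box (K := K) X Y k l) :
    b * c ∈ box (K := K) X Y (p + k) (q + l) := by
  have hY : ∀ j, Y ^ j * c ∈ box (K := K) X Y k (j + l) := by
    intro j
    induction j with
    | zero => simpa using hc
    | succ j ih =>
      rw [pow_succ', mul_assoc]
      exact box_mono X Y le_rfl (by omega) (left_mul_mem_box' h ih)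
  have hX : ∀ i j, X ^ i * (Y ^ j * c) ∈ box (K := K) X Y (i + k) (j + l) := by
    intro i j
    induction i with
    | zero => simpa using hY j
    | succ i ih =>
      rw [pow_succ', mul_assoc]
      exact box_mono X Y (by omega) le_rfl (left_mul_mem_box X Y ih)
  have : box X Y p q ≤ (box X Y (p + k) (q + l)).comap (LinearMap.mulRight K c) :=
    box_induction fun i j hi hj => by
      rw [Submodule.mem_comap, LinearMap.mulRight_apply, mul_assoc]
      exact box_mono X Y (by omega) (by omega) (hX i j)
  exact this hb

lemma normalForm_mem_box (X Y : R) (P : K[X][X]) :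
    ∃ k, normalForm X Y P ∈ box (K := K) X Y k k := by
  refine ⟨P.natDegree + 1 +
    (Finset.range (P.natDegree + 1)).sup fun j => (P.coeff j).natDegree, ?_⟩
  rw [normalForm_eq_sum]
  refine sum_mem fun j hj => ?_
  have hj' := Finset.mem_range.1 hj
  have hsup := Finset.le_sup (f := fun j => (P.coeff j).natDegree) hj
  rw [aeval_eq_sum_range, Finset.sum_mul]
  refine sum_mem fun i hi => ?_
  have hi' := Finset.mem_range.1 hi
  rw [smul_mul_assoc]
  refine Submodule.smul_mem _ _ (pow_mul_pow_mem_box X Y ?_ (by omega))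
  change (P.coeff j).natDegree ≤ _ at hsup
  omega

/-- `normalForm` as a linear map. -/
def normalFormHom (X Y : R) : K[X][X] →ₗ[K] R where
  toFun := normalForm X Y
  map_add' := normalForm_add X Y
  map_smul' r P := by
    have : r • P = C (C r) * P := by
      rw [← smul_eq_C_mul]
      ext
      simp
    rw [this, normalForm_C_mul, aeval_C, ← Algebra.smul_def, RingHom.id_apply]

lemma exists_normalForm_of_mem_box {X Y : R} {p q : ℕ} {b : R}
    (hb : b ∈ box (K := K) X Y p q) : ∃ P : K[X][X], b = normalForm X Y P := by
  have : box X Y p q ≤ LinearMap.range (normalFormHom (K := K) X Y) :=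
    box_induction fun i j _ _ => ⟨monomial j (Polynomial.X ^ i), by
      change normalForm X Y _ = _
      rw [normalForm_monomial, map_pow, aeval_X]⟩
  obtain ⟨P, hP⟩ := this hb
  exact ⟨P, hP.symm⟩

lemma finrank_box {X Y : R} (hinj : ∀ P : K[X][X], normalForm X Y P = 0 → P = 0) (p q : ℕ) :
    Module.finrank K (box (K := K) X Y p q) = p * q := by
  let b := (basisMonomials K).smulTower (basisMonomials K[X])
  have hker : LinearMap.ker (normalFormHom (K := K) X Y) = ⊥ := LinearMap.ker_eq_bot'.2 hinj
  have hli := b.linearIndependent.map' _ hker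
  have hval : ∀ ij : ℕ × ℕ, normalFormHom X Y (b ij) = X ^ ij.1 * Y ^ ij.2 := by
    rintro ⟨i, j⟩
    change normalForm X Y _ = _
    simp only [b, Module.Basis.smulTower_apply, coe_basisMonomials, smul_monomial, smul_eq_mul,
      mul_one]
    rw [normalForm_monomial, aeval_monomial, map_one, one_mul]
  have hinj2 : Function.Injective fun ij : Fin p × Fin q => ((ij.1 : ℕ), (ij.2 : ℕ)) := by
    rintro ⟨i, j⟩ ⟨i', j'⟩ hij
    simp only [Prod.mk.injEq] at hij
    exact Prod.ext (Fin.ext hij.1) (Fin.ext hij.2)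
  have := finrank_span_eq_card (hli.comp _ hinj2)
  have e : (normalFormHom X Y ∘ b) ∘ (fun ij : Fin p × Fin q => ((ij.1 : ℕ), (ij.2 : ℕ))) =
      fun ij : Fin p × Fin q => X ^ (ij.1 : ℕ) * Y ^ (ij.2 : ℕ) := funext fun ij => hval _
  rw [e] at this
  rw [box, this]
  simp

end Boxes

section SimpleModule

variable {K} {R M : Type*} [Ring R] [Algebra K R] [AddCommGroup M] [Module K M] [Module R M]
  [IsScalarTower K R M] {X Y J : R}

lemma rank_ker_lsmul_le_one (H : IsIntegroDifferential (K := K) X Y J) [IsSimpleModule R M] :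
    Module.rank K (LinearMap.ker (Algebra.lsmul K K M Y)) ≤ 1 := by
  rw [rank_le_one_iff]
  by_cases h0 : ∀ v : LinearMap.ker (Algebra.lsmul K K M Y), v = 0
  · exact ⟨0, fun v => ⟨0, by rw [h0 v, smul_zero]⟩⟩
  push Not at h0
  obtain ⟨v₀, hv₀⟩ := h0
  have hfix : ∀ v : LinearMap.ker (Algebra.lsmul K K M Y), (1 - J * Y) • (v : M) = v := by
    intro v
    have : Y • (v : M) = 0 := LinearMap.mem_ker.1 v.2
    rw [sub_smul, mul_smul, this, smul_zero, sub_zero, one_smul]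
  refine ⟨v₀, fun v => ?_⟩
  have hne : (v₀ : M) ≠ 0 := fun h => hv₀ (Subtype.ext h)
  obtain ⟨b, hb⟩ := IsSimpleModule.toSpanSingleton_surjective R hne (v : M)
  rw [LinearMap.toSpanSingleton_apply] at hb
  obtain ⟨r, hr⟩ := H.corner b
  refine ⟨r, Subtype.ext ?_⟩
  calc r • (v₀ : M) = r • ((1 - J * Y) • (v₀ : M)) := by rw [hfix]
    _ = ((1 - J * Y) * b * (1 - J * Y)) • (v₀ : M) := by rw [hr, smul_assoc]
    _ = v := by rw [mul_smul, mul_smul, hfix, hb, hfix]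

lemma exists_normalForm_smul_eq_zero (H : IsIntegroDifferential (K := K) X Y J)
    [IsSimpleModule R M] (v : M) : ∃ P : K[X][X], P ≠ 0 ∧ normalForm X Y P • v = 0 := by
  by_cases hw : (Y - 1) • v = 0
  · refine ⟨Polynomial.X ^ 1 - Polynomial.X ^ 0, fun h => ?_, ?_⟩
    · simpa using congrArg (eval 0) h
    · rwa [normalForm_sub, normalForm_X_pow, normalForm_X_pow, pow_one, pow_zero]
  · obtain ⟨b, hb⟩ := IsSimpleModule.toSpanSingleton_surjective R hw v
    rw [LinearMap.toSpanSingleton_apply] at hb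
    obtain ⟨N, Q, hQ⟩ := H.exists_pow_mul b
    refine ⟨Polynomial.X ^ N - (Q * Polynomial.X - Q), fun h => ?_, ?_⟩
    · simpa using congrArg (eval 1) h
    · have e : normalForm X Y Q * Y - normalForm X Y Q = Y ^ N * b * (Y - 1) := by
        rw [hQ, mul_sub, mul_one]
      rw [normalForm_sub, normalForm_sub, normalForm_X_pow, normalForm_mul_X, e, sub_smul,
        mul_smul, mul_smul, hb, sub_self]

/-- The orbit map `b ↦ b • v`. -/
def orbitMap (K : Type*) [Field K] {R M : Type*} [Ring R] [Algebra K R] [AddCommGroup M]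
    [Module K M] [Module R M] [IsScalarTower K R M] (v : M) : R →ₗ[K] M :=
  (LinearMap.toSpanSingleton R M v).restrictScalars K

lemma orbitMap_apply (v : M) (b : R) : orbitMap K v b = b • v := rfl

lemma exists_finrank_map_box_le (H : IsIntegroDifferential (K := K) X Y J) {v : M} {P : K[X][X]}
    (hP : P ≠ 0) (hv : normalForm X Y P • v = 0) :
    ∃ c : ℕ, ∀ n, Module.finrank K ((box X Y n n).map (orbitMap K v)) ≤ c * n := by
  obtain ⟨k, hk⟩ := normalForm_mem_box X Y P
  have hinj : ∀ Q : K[X][X], normalForm X Y Q = 0 → Q = 0 := fun Q hQ => by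
    by_contra h
    exact H.mul_ne_zero Q Q h h (by rw [hQ, mul_zero])
  refine ⟨2 * k, fun n => ?_⟩
  rcases le_total n k with hnk | hnk
  · have := Submodule.finrank_map_le (orbitMap K v) (box X Y n n)
    rw [finrank_box hinj] at this
    nlinarith
  obtain ⟨m, rfl⟩ := Nat.exists_eq_add_of_le' hnk
  let g := (orbitMap K v).domRestrict (box X Y (m + k) (m + k))
  let i : box (K := K) X Y m m →ₗ[K] LinearMap.ker g :=
    ((LinearMap.mulRight K (normalForm X Y P)).restrict (q := box X Y (m + k) (m + k))
      fun b hb => mul_mem_box H.commutator hb hk).codRestrict _ fun b => by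
        change ((b : R) * normalForm X Y P) • v = 0
        rw [mul_smul, hv, smul_zero]
  have hi : Function.Injective i := by
    refine (injective_iff_map_eq_zero i).2 fun b hb => ?_
    have hb' : (b : R) * normalForm X Y P = 0 :=
      congrArg (fun z : LinearMap.ker g => ((z : box (K := K) X Y (m + k) (m + k)) : R)) hb
    obtain ⟨Q, hQ⟩ := exists_normalForm_of_mem_box b.2
    by_contra hne
    refine H.mul_ne_zero Q P (fun h => hne (Subtype.ext ?_)) hP (hQ ▸ hb')
    rw [hQ, h]
    simp [normalForm]
  have h1 := LinearMap.finrank_le_finrank_of_injective hi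
  have h2 := LinearMap.finrank_range_add_finrank_ker g
  rw [LinearMap.range_domRestrict, finrank_box hinj] at h2
  rw [finrank_box hinj] at h1
  nlinarith

/-- The filtration of a cyclic module by words of bounded length in `X`, `Y` and `J`. -/
def wordFiltration (K : Type*) [Field K] {R M : Type*} [Ring R] [Algebra K R] [AddCommGroup M]
    [Module K M] [Module R M] [IsScalarTower K R M] (X Y J : R) (v : M) : ℕ → Submodule K M
  | 0 => Submodule.span K {v}
  | n + 1 => wordFiltration K X Y J v n ⊔ (wordFiltration K X Y J v n).map (Algebra.lsmul K K M X) ⊔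
      (wordFiltration K X Y J v n).map (Algebra.lsmul K K M Y) ⊔
      (wordFiltration K X Y J v n).map (Algebra.lsmul K K M J)

section wordFiltration

variable {v : M} {n : ℕ}

lemma wordFiltration_le_succ :
    wordFiltration K X Y J v n ≤ wordFiltration K X Y J v (n + 1) :=
  le_sup_of_le_left (le_sup_of_le_left le_sup_left)

lemma wordFiltration_mono : Monotone (wordFiltration K X Y J v) :=
  monotone_nat_of_le_succ fun _ => wordFiltration_le_succ

lemma smul_mem_wordFiltration {m : M} (hm : m ∈ wordFiltration K X Y J v n) :
    X • m ∈ wordFiltration K X Y J v (n + 1) ∧ Y • m ∈ wordFiltration K X Y J v (n + 1) ∧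
      J • m ∈ wordFiltration K X Y J v (n + 1) :=
  ⟨(le_sup_of_le_left (le_sup_of_le_left le_sup_right) :
      (wordFiltration K X Y J v n).map (Algebra.lsmul K K M X) ≤ wordFiltration K X Y J v (n + 1))
      (Submodule.mem_map_of_mem hm),
    (le_sup_of_le_left le_sup_right :
      (wordFiltration K X Y J v n).map (Algebra.lsmul K K M Y) ≤ wordFiltration K X Y J v (n + 1))
      (Submodule.mem_map_of_mem hm),
    (le_sup_right :
      (wordFiltration K X Y J v n).map (Algebra.lsmul K K M J) ≤ wordFiltration K X Y J v (n + 1))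
      (Submodule.mem_map_of_mem hm)⟩

instance finiteDimensional_wordFiltration : FiniteDimensional K (wordFiltration K X Y J v n) := by
  induction n with
  | zero => exact inferInstanceAs (FiniteDimensional K (Submodule.span K {v}))
  | succ n ih => rw [wordFiltration]; infer_instance

lemma exists_mem_wordFiltration (H : IsIntegroDifferential (K := K) X Y J) [IsSimpleModule R M]
    (hv : v ≠ 0) (m : M) : ∃ n, m ∈ wordFiltration K X Y J v n := by
  have key : ∀ a : R, ∀ n, ∀ u ∈ wordFiltration K X Y J v n,
      ∃ l, a • u ∈ wordFiltration K X Y J v l := by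
    refine H.induction _ (fun n u hu => ⟨_, (smul_mem_wordFiltration hu).1⟩)
      (fun n u hu => ⟨_, (smul_mem_wordFiltration hu).2.1⟩)
      (fun n u hu => ⟨_, (smul_mem_wordFiltration hu).2.2⟩) (fun r n u hu => ⟨n, ?_⟩)
      (fun a b ha hb n u hu => ?_) (fun a b ha hb n u hu => ?_)
    · rw [algebraMap_smul]
      exact Submodule.smul_mem _ _ hu
    · obtain ⟨k, hk⟩ := ha n u hu
      obtain ⟨l, hl⟩ := hb n u hu
      refine ⟨max k l, ?_⟩
      rw [add_smul]
      exact add_mem (wordFiltration_mono (le_max_left k l) hk)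
        (wordFiltration_mono (le_max_right k l) hl)
    · obtain ⟨l, hl⟩ := hb n u hu
      rw [mul_smul]
      exact ha l _ hl
  obtain ⟨a, rfl⟩ := IsSimpleModule.toSpanSingleton_surjective R hv m
  exact key a 0 v (Submodule.mem_span_singleton_self v)

lemma pow_smul_mem_map_box (H : IsIntegroDifferential (K := K) X Y J) :
    wordFiltration K X Y J v n ≤
      ((box X Y (2 * n + 1) (2 * n + 1)).map (orbitMap K v)).comap
        (Algebra.lsmul K K M (Y ^ n)) := by
  induction n with
  | zero =>
    rw [wordFiltration, Submodule.span_singleton_le_iff_mem]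
    refine ⟨X ^ 0 * Y ^ 0, pow_mul_pow_mem_box X Y (by omega) (by omega), ?_⟩
    simp [orbitMap_apply]
  | succ n ih =>
    have ih' : ∀ m ∈ wordFiltration K X Y J v n,
        ∃ b ∈ box (K := K) X Y (2 * n + 1) (2 * n + 1), b • v = Y ^ n • m := fun m hm => ih hm
    rw [wordFiltration]
    refine sup_le (sup_le (sup_le ?_ ?_) ?_) ?_
    · intro m hm
      obtain ⟨b, hb, e⟩ := ih' m hm
      refine ⟨Y * b, box_mono X Y (by omega) (by omega) (left_mul_mem_box' H.commutator hb), ?_⟩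
      change (Y * b) • v = Y ^ (n + 1) • m
      rw [pow_succ', mul_smul, mul_smul, e]
    · rintro _ ⟨m, hm, rfl⟩
      obtain ⟨b, hb, e⟩ := ih' m hm
      refine ⟨X * (Y * b) + (n + 1) • b, add_mem (box_mono X Y (by omega) (by omega)
        (left_mul_mem_box X Y (left_mul_mem_box' H.commutator hb)))
        (nsmul_mem (box_mono X Y (by omega) (by omega) hb) _), ?_⟩
      change (X * (Y * b) + (n + 1) • b) • v = Y ^ (n + 1) • X • m
      rw [← mul_smul, pow_mul_of_commutator H.commutator, add_smul (X * (Y * b)),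
        add_smul (X * Y ^ (n + 1)), pow_succ', mul_smul, mul_smul, mul_smul, mul_smul, smul_assoc,
        smul_assoc, e]
    · rintro _ ⟨m, hm, rfl⟩
      obtain ⟨b, hb, e⟩ := ih' m hm
      refine ⟨Y * (Y * b), box_mono X Y (by omega) (by omega)
        (left_mul_mem_box' H.commutator (left_mul_mem_box' H.commutator hb)), ?_⟩
      change (Y * (Y * b)) • v = Y ^ (n + 1) • Y • m
      rw [← mul_smul, ← pow_succ, pow_succ',
        pow_succ', mul_smul, mul_smul, mul_smul, mul_smul, e]
    · rintro _ ⟨m, hm, rfl⟩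
      obtain ⟨b, hb, e⟩ := ih' m hm
      refine ⟨b, box_mono X Y (by omega) (by omega) hb, ?_⟩
      change b • v = Y ^ (n + 1) • J • m
      rw [← mul_smul, pow_succ, mul_assoc,
        H.right_inv, mul_one, e]

end wordFiltration

lemma hasLinearGrowth_lsmul (H : IsIntegroDifferential (K := K) X Y J) [IsSimpleModule R M] :
    HasLinearGrowth (Algebra.lsmul K K M X) (Algebra.lsmul K K M Y) := by
  have := IsSimpleModule.nontrivial R M
  obtain ⟨v, hv⟩ := exists_ne (0 : M)
  obtain ⟨P, hP, hPv⟩ := exists_normalForm_smul_eq_zero H v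
  obtain ⟨c, hc⟩ := exists_finrank_map_box_le H hP hPv
  refine ⟨wordFiltration K X Y J v, 2 * c + 1, wordFiltration_mono, fun n => inferInstance,
    fun n => ?_, exists_mem_wordFiltration H hv, fun n m hm =>
      ⟨(smul_mem_wordFiltration hm).1, (smul_mem_wordFiltration hm).2.1⟩⟩
  let g := (Algebra.lsmul K K M (Y ^ n)).domRestrict (wordFiltration K X Y J v n)
  have hr : Module.finrank K (LinearMap.range g) ≤ c * (2 * n + 1) := by
    refine le_trans (Submodule.finrank_mono ?_) (hc (2 * n + 1))
    rw [LinearMap.range_domRestrict, Submodule.map_le_iff_le_comap]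
    exact pow_smul_mem_map_box H
  have hk : Module.finrank K (LinearMap.ker g) ≤ n := by
    refine Module.finrank_le_of_rank_le (le_trans ?_
      (rank_ker_pow_le (rank_ker_lsmul_le_one (M := M) H) n))
    let i : LinearMap.ker g →ₗ[K] LinearMap.ker (Algebra.lsmul K K M Y ^ n) :=
      ((wordFiltration K X Y J v n).subtype ∘ₗ (LinearMap.ker g).subtype).codRestrict _
        fun m => by
          rw [← map_pow]
          exact LinearMap.mem_ker.1 m.2
    exact LinearMap.rank_le_of_injective i fun x y hxy => Subtype.ext (Subtype.ext
      (congrArg (fun z : LinearMap.ker (Algebra.lsmul K K M Y ^ n) => (z : M)) hxy))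
  have h2 := LinearMap.finrank_range_add_finrank_ker g
  nlinarith

/-- The vectors killed by a nonzero polynomial in `Y` form an `R`-submodule. -/
lemma exists_aeval_smul_eq_zero (H : IsIntegroDifferential (K := K) X Y J) (a : R) :
    ∀ m : M, (∃ q : K[X], q ≠ 0 ∧ aeval Y q • m = 0) →
      ∃ q : K[X], q ≠ 0 ∧ aeval Y q • (a • m) = 0 := by
  have hcomm : (-X) * Y = Y * (-X) + 1 := by rw [neg_mul, mul_neg, H.commutator]; abel
  refine H.induction (fun a => ∀ m : M, (∃ q : K[X], q ≠ 0 ∧ aeval Y q • m = 0) →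
    ∃ q : K[X], q ≠ 0 ∧ aeval Y q • (a • m) = 0) ?_ ?_ ?_ ?_ ?_ ?_ a
  · rintro m ⟨q, hq, e⟩
    refine ⟨q * q, mul_ne_zero hq hq, ?_⟩
    have e1 := mul_aeval_of_commutator hcomm (q * q)
    have e2 : aeval Y (q * q) * X = X * aeval Y (q * q) + aeval Y (derivative (q * q)) := by
      rw [neg_mul, mul_neg] at e1
      rw [neg_eq_iff_eq_neg] at e1
      rw [e1]
      abel
    have e3 : derivative (q * q) = (2 * derivative q) * q := by rw [derivative_mul]; ring
    rw [← mul_smul, e2, add_smul, mul_smul, e3, map_mul, map_mul (aeval Y) _ q, mul_smul, mul_smul,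
      e, smul_zero, smul_zero, smul_zero, add_zero]
  · rintro m ⟨q, hq, e⟩
    refine ⟨q, hq, ?_⟩
    have : aeval Y q * Y = Y * aeval Y q := by
      have := congrArg (aeval Y) (mul_comm q Polynomial.X)
      rwa [map_mul, map_mul, aeval_X] at this
    rw [← mul_smul, this, mul_smul, e, smul_zero]
  · rintro m ⟨q, hq, e⟩
    refine ⟨q * Polynomial.X, mul_ne_zero hq X_ne_zero, ?_⟩
    rw [← mul_smul, map_mul, aeval_X, mul_assoc, H.right_inv, mul_one, e]
  · rintro r m ⟨q, hq, e⟩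
    refine ⟨q, hq, ?_⟩
    rw [algebraMap_smul, smul_comm, e, smul_zero]
  · rintro a b ha hb m hm
    obtain ⟨q, hq, e⟩ := ha m hm
    obtain ⟨r, hr, e'⟩ := hb m hm
    refine ⟨q * r, mul_ne_zero hq hr, ?_⟩
    rw [add_smul, smul_add, map_mul, mul_smul _ _ (b • m), e', smul_zero, add_zero, ← map_mul,
      mul_comm, map_mul, mul_smul, e, smul_zero]
  · rintro a b ha hb m hm
    rw [mul_smul]
    exact ha _ (hb m hm)

end SimpleModule

section Fredholm

variable {K} {R M : Type*} [Ring R] [Algebra K R] [AddCommGroup M] [Module K M] [Module R M]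
  [IsScalarTower K R M] {X Y J : R}

lemma commutator_lsmul (H : IsIntegroDifferential (K := K) X Y J) :
    Algebra.lsmul K K M Y * Algebra.lsmul K K M X =
      Algebra.lsmul K K M X * Algebra.lsmul K K M Y + 1 := by
  rw [← map_mul, H.commutator, map_add, map_mul, map_one]

lemma finiteDimensional_ker_lsmul_normalForm_of_simple
    (H : IsIntegroDifferential (K := K) X Y J) [IsSimpleModule R M] {P : K[X][X]} (hP : P ≠ 0) :
    FiniteDimensional K (LinearMap.ker (Algebra.lsmul K K M (normalForm X Y P))) := by
  have hcomm := commutator_lsmul (M := M) H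
  by_cases ht : ∃ m : M, m ≠ 0 ∧ ∃ q : K[X], q ≠ 0 ∧ aeval Y q • m = 0
  · obtain ⟨m, hm, hmt⟩ := ht
    rw [map_normalForm]
    refine finiteDimensional_ker_normalForm hcomm (hasLinearGrowth_lsmul H) (fun p u hu => ?_) hP
    by_contra! hpu
    obtain ⟨b, rfl⟩ := IsSimpleModule.toSpanSingleton_surjective R hm u
    obtain ⟨q, hq, e⟩ := exists_aeval_smul_eq_zero H b m hmt
    refine hpu.2 (eq_zero_of_torsion hcomm hpu.1 hq hu ?_)
    rw [aeval_algHom_apply]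
    exact e
  · push Not at ht
    have hcomm' : -X * Y = Y * -X + 1 := by rw [neg_mul, mul_neg, H.commutator]; abel
    obtain ⟨Q, hQ⟩ : ∃ Q : K[X][X], normalForm X Y P = normalForm Y (-X) Q := by
      refine exists_normalForm_of_mem_adjoin hcomm' ?_
      refine Algebra.adjoin_le ?_ (normalForm_mem_adjoin X Y P)
      have hX : -X ∈ Algebra.adjoin K {Y, -X} := Algebra.subset_adjoin (by simp)
      rintro z (rfl | rfl)
      · simpa using neg_mem hX
      · exact Algebra.subset_adjoin (by simp)
    have hQ0 : Q ≠ 0 := by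
      rintro rfl
      refine H.mul_ne_zero P P hP hP ?_
      rw [hQ]
      simp [normalForm]
    have hgr := (hasLinearGrowth_lsmul (M := M) H).symm_neg
    have hc : -Algebra.lsmul K K M X * Algebra.lsmul K K M Y =
        Algebra.lsmul K K M Y * -Algebra.lsmul K K M X + 1 := by
      rw [neg_mul, mul_neg, hcomm]; abel
    rw [hQ, map_normalForm, map_neg]
    refine finiteDimensional_ker_normalForm hc hgr (fun p u hu => ?_) hQ0
    by_contra! hpu
    refine ht u hpu.2 p hpu.1 ?_
    rw [aeval_algHom_apply] at hu
    exact hu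

/-- A `K`-linear endomorphism with finite-dimensional kernel and cokernel. -/
structure IsFredholm {V : Type*} [AddCommGroup V] [Module K V] (f : Module.End K V) : Prop where
  ker : FiniteDimensional K (LinearMap.ker f)
  coker : FiniteDimensional K (V ⧸ LinearMap.range f)

lemma exists_sup_range_eq_top {V : Type*} [AddCommGroup V] [Module K V] (f : Module.End K V)
    [FiniteDimensional K (V ⧸ LinearMap.range f)] :
    ∃ W : Submodule K V, FiniteDimensional K W ∧ ∀ v, ∃ w ∈ W, ∃ u, v = w + f u := by
  obtain ⟨s, hs⟩ := (LinearMap.range f).mkQ.exists_rightInverse_of_surjective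
    (LinearMap.range_eq_top.2 (Submodule.mkQ_surjective _))
  refine ⟨LinearMap.range s, inferInstance, fun v => ⟨s ((LinearMap.range f).mkQ v), ⟨_, rfl⟩, ?_⟩⟩
  have h := LinearMap.congr_fun hs ((LinearMap.range f).mkQ v)
  rw [LinearMap.comp_apply, LinearMap.id_apply, eq_comm] at h
  obtain ⟨u, hu⟩ := (Submodule.Quotient.eq _).1 h
  exact ⟨u, by rw [hu]; abel⟩

lemma finiteDimensional_coker_of_forall {V : Type*} [AddCommGroup V] [Module K V]
    (f : Module.End K V) (W : Submodule K V) [FiniteDimensional K W]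
    (h : ∀ v, ∃ w ∈ W, ∃ u, v = w + f u) : FiniteDimensional K (V ⧸ LinearMap.range f) := by
  refine Module.Finite.of_surjective ((LinearMap.range f).mkQ ∘ₗ W.subtype) fun z => ?_
  obtain ⟨v, rfl⟩ := Submodule.mkQ_surjective _ z
  obtain ⟨w, hw, u, rfl⟩ := h v
  refine ⟨⟨w, hw⟩, (Submodule.Quotient.eq _).2 ⟨-u, ?_⟩⟩
  rw [map_neg, Submodule.subtype_apply]
  abel

lemma IsFredholm.of_quotient {N : Submodule R M} {a : R} (h₁ : IsFredholm (Algebra.lsmul K K N a))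
    (h₂ : IsFredholm (Algebra.lsmul K K (M ⧸ N) a)) : IsFredholm (Algebra.lsmul K K M a) := by
  have := h₁.ker
  have := h₂.ker
  have := h₁.coker
  have := h₂.coker
  let π : M →ₗ[K] M ⧸ N := N.mkQ.restrictScalars K
  let ι : N →ₗ[K] M := N.subtype.restrictScalars K
  constructor
  · refine Module.Finite.iff_fg.2 (Submodule.fg_of_fg_map_of_fg_inf_ker π ?_ ?_)
    · have hle : (LinearMap.ker (Algebra.lsmul K K M a)).map π ≤
          LinearMap.ker (Algebra.lsmul K K (M ⧸ N) a) := by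
        rintro _ ⟨m, hm, rfl⟩
        have hm' : a • m = 0 := hm
        change a • N.mkQ m = 0
        rw [← map_smul, hm', map_zero]
      exact Module.Finite.iff_fg.1 (Submodule.finiteDimensional_of_le hle)
    · have hle : LinearMap.ker (Algebra.lsmul K K M a) ⊓ LinearMap.ker π ≤
          (LinearMap.ker (Algebra.lsmul K K N a)).map ι := by
        rintro m ⟨hm, hπ⟩
        exact ⟨⟨m, (Submodule.Quotient.mk_eq_zero N).1 hπ⟩, Subtype.ext hm, rfl⟩
      exact Module.Finite.iff_fg.1 (Submodule.finiteDimensional_of_le hle)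
  · obtain ⟨W₁, hW₁, h₁⟩ := exists_sup_range_eq_top (Algebra.lsmul K K N a)
    obtain ⟨W₂, hW₂, h₂⟩ := exists_sup_range_eq_top (Algebra.lsmul K K (M ⧸ N) a)
    obtain ⟨s, hs⟩ := π.exists_rightInverse_of_surjective
      (LinearMap.range_eq_top.2 (Submodule.mkQ_surjective N))
    refine finiteDimensional_coker_of_forall _ (W₁.map ι ⊔ W₂.map s) fun m => ?_
    obtain ⟨w₂, hw₂, z, hz⟩ := h₂ (π m)
    obtain ⟨u₂, rfl⟩ := Submodule.mkQ_surjective N z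
    have hN : m - s w₂ - a • u₂ ∈ N := by
      rw [← Submodule.Quotient.mk_eq_zero N]
      change π (m - s w₂ - a • u₂) = 0
      have e : π (s w₂) = w₂ := LinearMap.congr_fun hs w₂
      have e2 : π (a • u₂) = a • π u₂ := map_smul N.mkQ a u₂
      rw [map_sub, map_sub, e, hz, e2]
      change w₂ + a • π u₂ - w₂ - a • π u₂ = 0
      abel
    obtain ⟨w₁, hw₁, u₁, hu₁⟩ := h₁ ⟨_, hN⟩
    refine ⟨ι w₁ + s w₂, Submodule.add_mem_sup (Submodule.mem_map_of_mem hw₁)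
      (Submodule.mem_map_of_mem hw₂), u₁ + u₂, ?_⟩
    have e : m - s w₂ - a • u₂ = (w₁ : M) + a • (u₁ : M) := congrArg Subtype.val hu₁
    change m = (w₁ : M) + s w₂ + a • ((u₁ : M) + u₂)
    rw [smul_add, ← sub_eq_zero]
    rw [← sub_eq_zero] at e
    rw [← e]
    abel

lemma isFredholm_lsmul_normalForm (H : IsIntegroDifferential (K := K) X Y J) {P : K[X][X]}
    (hP : P ≠ 0) {M : Type*} [AddCommGroup M] [Module R M] (hM : IsFiniteLength R M) :
    ∀ [Module K M] [IsScalarTower K R M],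
      IsFredholm (Algebra.lsmul K K M (normalForm X Y P)) := by
  induction hM with
  | of_subsingleton => exact ⟨inferInstance, inferInstance⟩
  | @of_simple_quotient M _ _ N _ _ ih =>
    intro _ _
    refine IsFredholm.of_quotient (N := N) ih ?_
    have hker := finiteDimensional_ker_lsmul_normalForm_of_simple (M := M ⧸ N) H hP
    refine ⟨hker, ?_⟩
    rw [map_normalForm] at hker ⊢
    exact finiteDimensional_coker_of_ker (hasLinearGrowth_lsmul H) P hker

lemma finiteDimensional_ker_pow_lsmul (H : IsIntegroDifferential (K := K) X Y J)
    (hM : IsFiniteLength R M) (n : ℕ) :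
    FiniteDimensional K (LinearMap.ker (Algebra.lsmul K K M (Y ^ n))) := by
  have := (isFredholm_lsmul_normalForm H (pow_ne_zero n X_ne_zero) hM).ker
  rwa [normalForm_X_pow] at this

/-- An element of `R` acts with finite-dimensional kernel and cokernel as soon as no `Y ^ n`
annihilates it from the left. -/
theorem isFredholm_lsmul (H : IsIntegroDifferential (K := K) X Y J) (hM : IsFiniteLength R M)
    {a : R} (ha : ∀ n : ℕ, Y ^ n * a ≠ 0) : IsFredholm (Algebra.lsmul K K M a) := by
  obtain ⟨n, P, hP⟩ := H.exists_pow_mul a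
  have hP0 : P ≠ 0 := by
    rintro rfl
    exact ha n (by rw [hP]; simp [normalForm])
  have hF := isFredholm_lsmul_normalForm H hP0 hM
  rw [← hP] at hF
  have := hF.ker
  have := hF.coker
  have := finiteDimensional_ker_pow_lsmul (M := M) H hM n
  constructor
  · refine Submodule.finiteDimensional_of_le
      (S₂ := LinearMap.ker (Algebra.lsmul K K M (Y ^ n * a))) fun m hm => ?_
    have hm' : a • m = 0 := hm
    change (Y ^ n * a) • m = 0
    rw [mul_smul, hm', smul_zero]
  · obtain ⟨W, hW, h⟩ := exists_sup_range_eq_top (Algebra.lsmul K K M (Y ^ n * a))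
    have hYJ : Y ^ n * J ^ n = 1 := pow_mul_pow_eq_one n H.right_inv
    refine finiteDimensional_coker_of_forall _
      (LinearMap.ker (Algebra.lsmul K K M (Y ^ n)) ⊔ W.map (Algebra.lsmul K K M (J ^ n)))
      fun m => ?_
    obtain ⟨w, hw, u, hu⟩ := h (Y ^ n • m)
    replace hu : Y ^ n • m = w + (Y ^ n * a) • u := hu
    refine ⟨(m - J ^ n • w - a • u) + J ^ n • w,
      Submodule.add_mem_sup ?_ (Submodule.mem_map_of_mem hw), u, ?_⟩
    · change Y ^ n • (m - J ^ n • w - a • u) = 0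
      rw [smul_sub, smul_sub, hu, ← mul_smul, ← mul_smul, hYJ, one_smul]
      abel
    · change m = m - J ^ n • w - a • u + J ^ n • w + a • u
      abel

lemma finiteDimensional_range_corner (H : IsIntegroDifferential (K := K) X Y J)
    (hM : IsFiniteLength R M) (i j : ℕ) :
    FiniteDimensional K
      (LinearMap.range (Algebra.lsmul K K M (J ^ i * (1 - J * Y) * Y ^ j))) := by
  have := finiteDimensional_ker_pow_lsmul (M := M) H hM 1
  refine Submodule.finiteDimensional_of_le (S₂ := (LinearMap.ker (Algebra.lsmul K K M (Y ^ 1))).map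
    (Algebra.lsmul K K M (J ^ i))) ?_
  rintro _ ⟨m, rfl⟩
  refine ⟨((1 - J * Y) * Y ^ j) • m, ?_, ?_⟩
  · change Y ^ 1 • ((1 - J * Y) * Y ^ j) • m = 0
    rw [← mul_smul, ← mul_assoc, pow_one, mul_sub, ← mul_assoc, H.right_inv, one_mul, mul_one,
      sub_self, zero_mul, zero_smul]
  · change J ^ i • ((1 - J * Y) * Y ^ j) • m = (J ^ i * (1 - J * Y) * Y ^ j) • m
    rw [← mul_smul, mul_assoc]

lemma finiteDimensional_of_ker_of_range {V : Type*} [AddCommGroup V] [Module K V]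
    (f : Module.End K V) [FiniteDimensional K (LinearMap.ker f)]
    [FiniteDimensional K (LinearMap.range f)] : FiniteDimensional K V :=
  have := f.quotKerEquivRange.symm.finiteDimensional
  Module.Finite.of_submodule_quotient (LinearMap.ker f)

end Fredholm

section CompactFredholm

variable {K}

lemma isIntegroDifferential_I1 : IsIntegroDifferential (K := K) xI (derI K) (intI K) where
  commutator := derI_mul_xI
  right_inv := derI_mul_intI
  induction _ hx hd hi hc hadd hmul := I1_induction hx hd hi hc hadd hmul
  corner b := by
    rw [← eI_zero_eq]
    exact exists_eI_mul_mul_eI b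
  mul_ne_zero _ _ hP hQ := normalForm_mul_ne_zero hP hQ
  exists_pow_mul := exists_pow_derI_mul_eq_normalForm

lemma eI_eq_mul (i j : ℕ) : eI K i j = intI K ^ i * (1 - intI K * derI K) * derI K ^ j := by
  rw [← eI_zero_eq]
  exact Subtype.ext (eOp_eq_mul i j)

variable {M : Type*} [AddCommGroup M] [Module (I1 K) M] [Module K M] [IsScalarTower K (I1 K) M]

lemma finiteDimensional_range_of_mem_Fset (hM : IsFiniteLength (I1 K) M) {a : I1 K}
    (ha : (a : Module.End K K[X]) ∈ Fset K) :
    FiniteDimensional K (LinearMap.range (Algebra.lsmul K K M a)) := by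
  suffices h : ∀ f ∈ Fset K, ∃ b : I1 K, (b : Module.End K K[X]) = f ∧
      FiniteDimensional K (LinearMap.range (Algebra.lsmul K K M b)) by
    obtain ⟨b, hb, hfin⟩ := h a ha
    rwa [← Subtype.ext hb]
  intro f hf
  induction hf using Submodule.span_induction with
  | mem f hf =>
    obtain ⟨i, j, rfl⟩ := hf
    refine ⟨eI K i j, rfl, ?_⟩
    rw [eI_eq_mul]
    exact finiteDimensional_range_corner isIntegroDifferential_I1 hM i j
  | zero =>
    refine ⟨0, rfl, ?_⟩
    rw [map_zero, LinearMap.range_zero]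
    infer_instance
  | add f g _ _ hf hg =>
    obtain ⟨b, rfl, hb⟩ := hf
    obtain ⟨c, rfl, hc⟩ := hg
    refine ⟨b + c, rfl, ?_⟩
    rw [map_add]
    exact Submodule.finiteDimensional_of_le (LinearMap.range_add_le _ _)
  | smul r f _ hf =>
    obtain ⟨b, rfl, hb⟩ := hf
    refine ⟨r • b, rfl, ?_⟩
    rw [map_smul]
    refine Submodule.finiteDimensional_of_le (S₂ := LinearMap.range (Algebra.lsmul K K M b)) ?_
    rintro _ ⟨m, rfl⟩
    exact Submodule.smul_mem _ r ⟨m, rfl⟩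

lemma isFredholm_of_notMem_Fset (hM : IsFiniteLength (I1 K) M) {a : I1 K}
    (ha : (a : Module.End K K[X]) ∉ Fset K) : IsFredholm (Algebra.lsmul K K M a) :=
  isFredholm_lsmul isIntegroDifferential_I1 hM fun _ h => ha (mem_Fset_of_pow_derI_mul_eq_zero h)

end CompactFredholm

/-- the Strong Compact–Fredholm Alternative for `I₁`. -/
theorem statement1 (a : I1 K) (M : Type*) [AddCommGroup M] [Nontrivial M]
    [Module (I1 K) M] [Module K M] [IsScalarTower K (I1 K) M] [SMulCommClass K (I1 K) M]
    (hM : IsFiniteLength (I1 K) M) :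
    ((FiniteDimensional K ↥(LinearMap.ker (actMap K a M)) ↔
        FiniteDimensional K (M ⧸ LinearMap.range (actMap K a M)))
      ∧ (FiniteDimensional K ↥(LinearMap.ker (actMap K a M)) ↔
          (a : Module.End K (Polynomial K)) ∉ Fset K))
    ∧ (IsSimpleModule (I1 K) M →
        (FiniteDimensional K ↥(LinearMap.range (actMap K a M)) ↔
          (a : Module.End K (Polynomial K)) ∈ Fset K)) := by
  have hinf : ¬ FiniteDimensional K M :=
    not_finiteDimensional_of_commutator (commutator_lsmul isIntegroDifferential_I1)
  have hact : actMap K a M = Algebra.lsmul K K M a := rfl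
  rw [hact]
  by_cases ha : (a : Module.End K K[X]) ∈ Fset K
  · have hr := finiteDimensional_range_of_mem_Fset hM ha
    have hker : ¬ FiniteDimensional K (LinearMap.ker (Algebra.lsmul K K M a)) := fun _ =>
      hinf (finiteDimensional_of_ker_of_range (Algebra.lsmul K K M a))
    have hcoker : ¬ FiniteDimensional K (M ⧸ LinearMap.range (Algebra.lsmul K K M a)) := fun _ =>
      hinf (Module.Finite.of_submodule_quotient (LinearMap.range (Algebra.lsmul K K M a)))
    exact ⟨⟨iff_of_false hker hcoker, iff_of_false hker (not_not.2 ha)⟩, fun _ => iff_of_true hr ha⟩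
  · have hF := isFredholm_of_notMem_Fset hM ha
    have := hF.coker
    exact ⟨⟨iff_of_true hF.ker hF.coker, iff_of_true hF.ker ha⟩, fun _ => iff_of_false
      (fun _ => hinf (Module.Finite.of_submodule_quotient
        (LinearMap.range (Algebra.lsmul K K M a)))) ha⟩

end
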